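/- Let D ∈ H⁴ with fundamental invariants J₂, …, J₁₀. There exist g ∈ SO(3) and δ ∈ ℝ with g·D = NF_cubic(δ) (i.e., D lies in the closed cubic stratum) if and only if 3J₄ = J₂², J₅ = 0, 30J₃² = J₂³, 9J₆ = J₂³, and J₇ = J₈ = J₉ = J₁₀ = 0. Moreover, if in addition J₂ ≠ 0, then the parameter is given by 4δ = J₃ / J₂. -/

import Mathlib

open Matrix BigOperators

abbrev Mat3 := Matrix (Fin 3) (Fin 3) ℝ
abbrev T4 := Fin 3 → Fin 3 → Fin 3 → Fin 3 → ℝ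

/-- `g ∈ SO(3)`: real orthogonal 3×3 matrix of determinant 1. -/
def IsSO3 (g : Mat3) : Prop := g * gᵀ = 1 ∧ g.det = 1

/-- A harmonic fourth-order tensor: totally symmetric and traceless. -/
def IsHarm (D : T4) : Prop :=
  (∀ i j k l, D i j k l = D j i k l) ∧
  (∀ i j k l, D i j k l = D i k j l) ∧
  (∀ i j k l, D i j k l = D i j l k) ∧
  (∀ i j, ∑ k, D k k i j = 0)

/-- The action of a rotation `g` on a fourth-order tensor. -/
noncomputable def act (g : Mat3) (D : T4) : T4 := fun i j k l =>
  ∑ p, ∑ q, ∑ r, ∑ s, g i p * g j q * g k r * g l s * D p q r s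

/-- `D²`, the square of a fourth-order tensor. -/
noncomputable def sqT (D : T4) : T4 := fun i j k l => ∑ p, ∑ q, D i j p q * D p q k l

/-- `D³`, the cube of a fourth-order tensor. -/
noncomputable def cbT (D : T4) : T4 := fun i j k l => ∑ p, ∑ q, sqT D i j p q * D p q k l

/-- The second-order Boehler covariant `d₂(D) j l = ∑ᵢ (D²) i j i l`. -/
noncomputable def d2 (D : T4) : Mat3 := Matrix.of fun j l => ∑ i, sqT D i j i l

/-- The second-order covariant `d₃(D) j l = ∑ᵢ (D³) i j i l`. -/
noncomputable def d3 (D : T4) : Mat3 := Matrix.of fun j l => ∑ i, cbT D i j i l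

/-- Fundamental invariant `J₂ = tr d₂`. -/
noncomputable def J2 (D : T4) : ℝ := (d2 D).trace
/-- Fundamental invariant `J₃ = tr d₃`. -/
noncomputable def J3 (D : T4) : ℝ := (d3 D).trace
/-- Fundamental invariant `J₄ = tr(d₂²)`. -/
noncomputable def J4 (D : T4) : ℝ := (d2 D * d2 D).trace
/-- Fundamental invariant `J₅ = ∑ (d₂)ᵢⱼ D i j k l (d₂)ₖₗ`. -/
noncomputable def J5 (D : T4) : ℝ :=
  ∑ i, ∑ j, ∑ k, ∑ l, d2 D i j * D i j k l * d2 D k l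
/-- Fundamental invariant `J₆ = tr(d₂³)`. -/
noncomputable def J6 (D : T4) : ℝ := (d2 D * d2 D * d2 D).trace
/-- Fundamental invariant `J₇ = ∑ (d₂²)ᵢⱼ D i j k l (d₂)ₖₗ`. -/
noncomputable def J7 (D : T4) : ℝ :=
  ∑ i, ∑ j, ∑ k, ∑ l, (d2 D * d2 D) i j * D i j k l * d2 D k l
/-- Fundamental invariant `J₈ = ∑ (d₂²)ᵢⱼ (D²) i j k l (d₂)ₖₗ`. -/
noncomputable def J8 (D : T4) : ℝ :=
  ∑ i, ∑ j, ∑ k, ∑ l, (d2 D * d2 D) i j * sqT D i j k l * d2 D k l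
/-- Fundamental invariant `J₉ = ∑ (d₂²)ᵢⱼ D i j k l (d₂²)ₖₗ`. -/
noncomputable def J9 (D : T4) : ℝ :=
  ∑ i, ∑ j, ∑ k, ∑ l, (d2 D * d2 D) i j * D i j k l * (d2 D * d2 D) k l
/-- Fundamental invariant `J₁₀ = ∑ (d₂²)ᵢⱼ (D²) i j k l (d₂²)ₖₗ`. -/
noncomputable def J10 (D : T4) : ℝ :=
  ∑ i, ∑ j, ∑ k, ∑ l, (d2 D * d2 D) i j * sqT D i j k l * (d2 D * d2 D) k l

/-- The totally symmetric tensor whose value at `(i,j,k,l)` depends only on the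
multiset of indices `{i,j,k,l}`. -/
noncomputable def symT (f : Multiset (Fin 3) → ℝ) : T4 := fun i j k l => f {i, j, k, l}

/-- Normal form of a cubic (`[𝕆]`) tensor in `H⁴` with parameter `δ`
(indices `0,1,2` correspond to `1,2,3`). -/
noncomputable def NFcubic (δ : ℝ) : T4 := symT fun m =>
  if m = {0, 0, 0, 0} ∨ m = {1, 1, 1, 1} ∨ m = {2, 2, 2, 2} then 8 * δ
  else if m = {0, 0, 1, 1} ∨ m = {0, 0, 2, 2} ∨ m = {1, 1, 2, 2} then -(4 * δ)
  else 0

/-- Normal form of a transversely isotropic (`[O(2)]`) tensor in `H⁴` with parameter `δ`. -/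
noncomputable def NFti (δ : ℝ) : T4 := symT fun m =>
  if m = {0, 0, 0, 0} ∨ m = {1, 1, 1, 1} then 3 * δ
  else if m = {2, 2, 2, 2} then 8 * δ
  else if m = {0, 0, 1, 1} then δ
  else if m = {0, 0, 2, 2} ∨ m = {1, 1, 2, 2} then -(4 * δ)
  else 0

/-- Normal form of a trigonal (`[𝔻₃]`) tensor in `H⁴` with parameters `δ, σ`. -/
noncomputable def NFtrig (δ σ : ℝ) : T4 := symT fun m =>
  if m = {0, 0, 0, 0} ∨ m = {1, 1, 1, 1} then 3 * δ
  else if m = {2, 2, 2, 2} then 8 * δ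
  else if m = {0, 0, 1, 1} then δ
  else if m = {0, 0, 2, 2} ∨ m = {1, 1, 2, 2} then -(4 * δ)
  else if m = {0, 0, 1, 2} then -σ
  else if m = {1, 1, 1, 2} then σ
  else 0

/-- Normal form of a tetragonal (`[𝔻₄]`) tensor in `H⁴` with parameters `δ, σ`. -/
noncomputable def NFtetra (δ σ : ℝ) : T4 := symT fun m =>
  if m = {0, 0, 0, 0} ∨ m = {1, 1, 1, 1} then 3 * δ - σ
  else if m = {2, 2, 2, 2} then 8 * δ
  else if m = {0, 0, 1, 1} then δ + σ
  else if m = {0, 0, 2, 2} ∨ m = {1, 1, 2, 2} then -(4 * δ)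
  else 0

/-- Normal form of an orthotropic (`[𝔻₂]`) tensor in `H⁴` with parameters `λ₁, λ₂, λ₃`. -/
noncomputable def NForth (l1 l2 l3 : ℝ) : T4 := symT fun m =>
  if m = {0, 0, 0, 0} then -l2 - l3
  else if m = {1, 1, 1, 1} then -l1 - l3
  else if m = {2, 2, 2, 2} then -l1 - l2
  else if m = {0, 0, 1, 1} then l3
  else if m = {0, 0, 2, 2} then l2
  else if m = {1, 1, 2, 2} then l1
  else 0

/-- The orthogonal projection onto symmetric traceless matrices, as a fourth-order tensor. -/
noncomputable def devProj : T4 := fun i j k l =>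
  ((if i = k then 1 else 0) * (if j = l then 1 else 0) +
    (if i = l then 1 else 0) * (if j = k then 1 else 0)) / 2 -
    (if i = j then 1 else 0) * (if k = l then 1 else 0) / 3

theorem J3_eq_sum (D : T4) : J3 D = ∑ i, ∑ j, cbT D i j i j := by
  rw [Finset.sum_comm]; rfl

theorem IsHarm.trace_relations {D : T4} (hD : IsHarm D) :
    D 0 0 2 2 = -D 0 0 0 0 - D 0 0 1 1 ∧ D 0 1 2 2 = -D 0 0 0 1 - D 0 1 1 1 ∧
    D 0 2 2 2 = -D 0 0 0 2 - D 0 1 1 2 ∧ D 1 1 2 2 = -D 0 0 1 1 - D 1 1 1 1 ∧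
    D 1 2 2 2 = -D 0 0 1 2 - D 1 1 1 2 ∧
    D 2 2 2 2 = D 0 0 0 0 + 2 * D 0 0 1 1 + D 1 1 1 1 := by
  obtain ⟨h1, h2, h3, h4⟩ := hD
  have a := h4 0 0
  have b := h4 0 1
  have c := h4 0 2
  have d := h4 1 1
  have e := h4 1 2
  have f := h4 2 2
  simp only [Fin.sum_univ_three, h1, h2, h3] at a b c d e f
  refine ⟨?_, ?_, ?_, ?_, ?_, ?_⟩ <;> linarith

theorem IsHarm.sum_sqT_sq {D : T4} (hD : IsHarm D) :
    ∑ i, ∑ j, ∑ k, ∑ l, sqT D i j k l ^ 2 = (-3/10) * J2 D ^ 2 + (8/5) * J4 D := by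
  obtain ⟨r1, r2, r3, r4, r5, r6⟩ := hD.trace_relations
  obtain ⟨h1, h2, h3, h4⟩ := hD
  simp only [J2, J4, d2, Matrix.trace, Matrix.diag_apply, Matrix.mul_apply, Matrix.of_apply,
    sqT, Fin.sum_univ_three, h1, h2, h3, r1, r2, r3, r4, r5, r6]
  ring

theorem IsHarm.sqT_eq {D : T4} (hD : IsHarm D) {δ : ℝ} (hd : d2 D = (160 * δ ^ 2) • 1)
    (hJ : J3 D = 1920 * δ ^ 3) (i j k l : Fin 3) :
    sqT D i j k l = 4 * δ * D i j k l + 96 * δ ^ 2 * devProj i j k l := by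
  have hJ2 : J2 D = 480 * δ ^ 2 := by simp [J2, hd]; ring
  have hJ4 : J4 D = 76800 * δ ^ 4 := by simp [J4, hd]; ring
  have hsum : ∑ i, ∑ j, ∑ k, ∑ l,
      (sqT D i j k l - 4 * δ * D i j k l - 96 * δ ^ 2 * devProj i j k l) ^ 2 =
      ∑ i, ∑ j, ∑ k, ∑ l, sqT D i j k l ^ 2 - 8 * δ * J3 D - 176 * δ ^ 2 * J2 D
        + 46080 * δ ^ 4 := by
    obtain ⟨r1, r2, r3, r4, r5, r6⟩ := hD.trace_relations
    obtain ⟨h1, h2, h3, h4⟩ := hD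
    simp [J3_eq_sum, J2, d2, Matrix.trace, Matrix.of_apply, cbT, sqT, devProj,
      Fin.sum_univ_three, h1, h2, h3, r1, r2, r3, r4, r5, r6]
    ring
  rw [hD.sum_sqT_sq, hJ2, hJ4, hJ] at hsum
  have h0 : ∑ i, ∑ j, ∑ k, ∑ l,
      (sqT D i j k l - 4 * δ * D i j k l - 96 * δ ^ 2 * devProj i j k l) ^ 2 = 0 := by
    rw [hsum]; ring
  have h1 : ∑ x : Fin 3 × Fin 3 × Fin 3 × Fin 3, (sqT D x.1 x.2.1 x.2.2.1 x.2.2.2 -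
      4 * δ * D x.1 x.2.1 x.2.2.1 x.2.2.2 -
      96 * δ ^ 2 * devProj x.1 x.2.1 x.2.2.1 x.2.2.2) ^ 2 = 0 := by
    simpa only [Fintype.sum_prod_type] using h0
  have h2 := (Finset.sum_eq_zero_iff_of_nonneg fun _ _ => sq_nonneg _).1 h1 (i, j, k, l)
    (Finset.mem_univ _)
  have h3 := pow_eq_zero_iff two_ne_zero |>.1 h2
  linarith

/-- A fourth-order tensor as a square matrix indexed by pairs. -/
def toMat (D : T4) : Matrix (Fin 3 × Fin 3) (Fin 3 × Fin 3) ℝ :=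
  Matrix.of fun x y => D x.1 x.2 y.1 y.2

theorem toMat_injective : Function.Injective toMat := fun D E h => by
  ext i j k l
  exact congrFun₂ h (i, j) (k, l)

open Kronecker in
theorem toMat_act (g : Mat3) (D : T4) :
    toMat (act g D) = (g ⊗ₖ g) * toMat D * (g ⊗ₖ g)ᵀ := by
  ext ⟨i, j⟩ ⟨k, l⟩
  simp only [toMat, act, Matrix.mul_apply, Matrix.of_apply, Matrix.transpose_apply,
    Matrix.kroneckerMap_apply, Fintype.sum_prod_type, Fin.sum_univ_three]
  ring

theorem toMat_sqT (D : T4) : toMat (sqT D) = toMat D * toMat D := by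
  ext x y
  simp [toMat, sqT, Matrix.mul_apply, Fintype.sum_prod_type]

theorem toMat_cbT (D : T4) : toMat (cbT D) = toMat D * toMat D * toMat D := by
  rw [← toMat_sqT]
  ext x y
  simp [toMat, cbT, Matrix.mul_apply, Fintype.sum_prod_type]

open Kronecker in
theorem kronecker_transpose_mul_self {g : Mat3} (hg : gᵀ * g = 1) :
    (g ⊗ₖ g)ᵀ * (g ⊗ₖ g) = 1 := by
  rw [← Matrix.kroneckerMap_transpose, ← Matrix.mul_kronecker_mul, hg, Matrix.one_kronecker_one]

theorem sqT_act {g : Mat3} (hg : gᵀ * g = 1) (D : T4) : sqT (act g D) = act g (sqT D) := by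
  apply toMat_injective
  rw [toMat_act, toMat_sqT, toMat_sqT, toMat_act]
  simp only [Matrix.mul_assoc]
  rw [← Matrix.mul_assoc _ _ (toMat D * _), kronecker_transpose_mul_self hg, Matrix.one_mul]

theorem J3_eq_trace (D : T4) : J3 D = (toMat (cbT D)).trace := by
  simp only [J3, d3, toMat, Matrix.trace, Matrix.diag_apply, Matrix.of_apply,
    Fintype.sum_prod_type]
  rw [Finset.sum_comm]

theorem J3_act {g : Mat3} (hg : gᵀ * g = 1) (D : T4) : J3 (act g D) = J3 D := by
  have h : toMat (cbT (act g D)) = toMat (act g (cbT D)) := by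
    rw [toMat_cbT, ← toMat_sqT, sqT_act hg, toMat_act, toMat_act, toMat_act, toMat_cbT, toMat_sqT]
    simp only [Matrix.mul_assoc]
    rw [← Matrix.mul_assoc (Matrix.transpose _) _ (toMat D * _), kronecker_transpose_mul_self hg,
      Matrix.one_mul]
  rw [J3_eq_trace, J3_eq_trace, h, toMat_act, Matrix.trace_mul_comm, ← Matrix.mul_assoc,
    kronecker_transpose_mul_self hg, Matrix.one_mul]

theorem sum_act_contract {g : Mat3} (hg : gᵀ * g = 1) (T : T4) (j l : Fin 3) :
    ∑ i, act g T i j i l = ∑ q, ∑ s, g j q * g l s * ∑ p, T p q p s := by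
  have hg' (p r : Fin 3) : ∑ i, g i p * g i r = if p = r then 1 else 0 := by
    have := congrFun₂ hg p r
    simpa [Matrix.mul_apply, Matrix.one_apply] using this
  have h : ∑ i, act g T i j i l =
      ∑ p, ∑ q, ∑ r, ∑ s, (∑ i, g i p * g i r) * (g j q * g l s * T p q r s) := by
    simp only [act, Fin.sum_univ_three]
    ring
  rw [h]
  simp only [hg', Fin.sum_univ_three]
  simp
  ring

theorem d2_act {g : Mat3} (hg : gᵀ * g = 1) (D : T4) : d2 (act g D) = g * d2 D * gᵀ := by
  ext j l
  rw [d2, Matrix.of_apply, sqT_act hg, sum_act_contract hg]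
  simp only [d2, Matrix.mul_apply, Matrix.of_apply, Matrix.transpose_apply, Finset.sum_mul]
  rw [Finset.sum_comm]
  refine Finset.sum_congr rfl fun s _ => Finset.sum_congr rfl fun q _ => ?_
  ring

theorem isHarm_act {D : T4} (hD : IsHarm D) {g : Mat3} (hg : gᵀ * g = 1) :
    IsHarm (act g D) := by
  obtain ⟨h1, h2, h3, h4⟩ := hD
  have s2 (i j k l : Fin 3) : act g D i j k l = act g D i k j l := by
    unfold act
    refine Finset.sum_congr rfl fun p _ => ?_
    rw [Finset.sum_comm]
    refine Finset.sum_congr rfl fun q _ => Finset.sum_congr rfl fun r _ =>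
      Finset.sum_congr rfl fun s _ => ?_
    rw [h2]; ring
  refine ⟨fun i j k l => ?_, s2, fun i j k l => ?_, fun i j => ?_⟩
  · unfold act
    rw [Finset.sum_comm]
    refine Finset.sum_congr rfl fun p _ => Finset.sum_congr rfl fun q _ =>
      Finset.sum_congr rfl fun r _ => Finset.sum_congr rfl fun s _ => ?_
    rw [h1]; ring
  · unfold act
    refine Finset.sum_congr rfl fun p _ => Finset.sum_congr rfl fun q _ => ?_
    rw [Finset.sum_comm]
    refine Finset.sum_congr rfl fun r _ => Finset.sum_congr rfl fun s _ => ?_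
    rw [h3]; ring
  · simp only [fun k => s2 k k i j]
    rw [sum_act_contract hg]
    refine Finset.sum_eq_zero fun q _ => Finset.sum_eq_zero fun s _ => ?_
    rw [show ∑ p, D p q p s = 0 by rw [← h4 q s]; exact Finset.sum_congr rfl fun p _ => h2 ..,
      mul_zero]

/-- The double contraction of a fourth-order tensor with a matrix. -/
noncomputable def contract (D : T4) (A : Mat3) : Mat3 :=
  Matrix.of fun i j => ∑ p, ∑ q, D i j p q * A p q

open Kronecker in
theorem contract_act {g : Mat3} (hg : gᵀ * g = 1) (D : T4) (A : Mat3) :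
    contract (act g D) (g * A * gᵀ) = g * contract D A * gᵀ := by
  have hc (D : T4) (A : Mat3) :
      (fun x : Fin 3 × Fin 3 => contract D A x.1 x.2) = toMat D *ᵥ fun x => A x.1 x.2 := by
    ext x
    simp [contract, toMat, Matrix.mulVec, dotProduct, Fintype.sum_prod_type]
  have hk (A : Mat3) :
      (fun x : Fin 3 × Fin 3 => (g * A * gᵀ) x.1 x.2) = (g ⊗ₖ g) *ᵥ fun x => A x.1 x.2 := by
    ext ⟨i, j⟩
    simp only [Matrix.mulVec, dotProduct, Matrix.mul_apply, Matrix.transpose_apply,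
      Matrix.kroneckerMap_apply, Fintype.sum_prod_type, Fin.sum_univ_three]
    ring
  have h : (fun x : Fin 3 × Fin 3 => contract (act g D) (g * A * gᵀ) x.1 x.2) =
      fun x => (g * contract D A * gᵀ) x.1 x.2 := by
    rw [hc, hk, hk, hc, toMat_act, Matrix.mulVec_mulVec, Matrix.mulVec_mulVec, Matrix.mul_assoc,
      kronecker_transpose_mul_self hg, Matrix.mul_one]
  ext i j
  exact congrFun h (i, j)

theorem Fin.forall_fin_three {p : Fin 3 → Prop} : (∀ i, p i) ↔ p 0 ∧ p 1 ∧ p 2 :=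
  ⟨fun h => ⟨h 0, h 1, h 2⟩, fun ⟨h0, h1, h2⟩ i => by fin_cases i <;> assumption⟩

theorem IsHarm.ext {D E : T4} (hD : IsHarm D) (hE : IsHarm E)
    (u : D 0 0 0 0 = E 0 0 0 0) (v : D 1 1 1 1 = E 1 1 1 1) (w : D 0 0 1 1 = E 0 0 1 1)
    (h1 : D 0 0 0 1 = E 0 0 0 1)
    (h2 : D 0 1 1 1 = E 0 1 1 1) (h3 : D 0 0 0 2 = E 0 0 0 2) (h4 : D 0 1 1 2 = E 0 1 1 2)
    (h5 : D 0 0 1 2 = E 0 0 1 2) (h6 : D 1 1 1 2 = E 1 1 1 2) : D = E := by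
  obtain ⟨r1, r2, r3, r4, r5, r6⟩ := hD.trace_relations
  obtain ⟨s1, s2, s3, s4, s5, s6⟩ := hE.trace_relations
  obtain ⟨a1, a2, a3, -⟩ := hD
  obtain ⟨b1, b2, b3, -⟩ := hE
  suffices hDE : ∀ i j k l, D i j k l = E i j k l by
    ext i j k l
    exact hDE i j k l
  simp only [Fin.forall_fin_three, a1, a2, a3, b1, b2, b3, r1, r2, r3, r4, r5, r6, s1, s2, s3, s4,
    s5, s6, u, v, w, h1, h2, h3, h4, h5, h6, and_self]

theorem NFcubic_iiii (δ : ℝ) (i : Fin 3) : NFcubic δ i i i i = 8 * δ := by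
  simp only [NFcubic, symT]
  rw [if_pos]
  revert i
  decide

theorem NFcubic_iijj (δ : ℝ) {i j : Fin 3} (h : i ≠ j) : NFcubic δ i i j j = -(4 * δ) := by
  simp only [NFcubic, symT]
  rw [if_neg, if_pos] <;> revert i j <;> decide

theorem NFcubic_odd (δ : ℝ) {i j k : Fin 3} (h : i ≠ j) : NFcubic δ i j k k = 0 := by
  simp only [NFcubic, symT]
  rw [if_neg, if_neg] <;> revert i j k <;> decide

theorem NFcubic_isHarm (δ : ℝ) : IsHarm (NFcubic δ) := by
  refine ⟨fun i j k l => ?_, fun i j k l => ?_, fun i j k l => ?_, fun i j => ?_⟩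
  · simp only [NFcubic, symT, Multiset.insert_eq_cons, Multiset.cons_swap i j]
  · simp only [NFcubic, symT, Multiset.insert_eq_cons, Multiset.cons_swap j k]
  · simp only [NFcubic, symT, Multiset.insert_eq_cons, Multiset.pair_comm k l]
  · have hs (k : Fin 3) : NFcubic δ k k i j = NFcubic δ i j k k := by
      have h : ({k, k, i, j} : Multiset (Fin 3)) = {i, j, k, k} := by
        revert i j k; decide
      simp only [NFcubic, symT, h]
    simp only [hs]
    by_cases h : i = j
    · subst h
      fin_cases i <;> simp [Fin.sum_univ_three, NFcubic_iiii, NFcubic_iijj] <;> ring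
    · simp [NFcubic_odd δ h]

theorem NFcubic_odd_components (δ : ℝ) :
    NFcubic δ 0 0 0 1 = 0 ∧ NFcubic δ 0 1 1 1 = 0 ∧ NFcubic δ 0 0 0 2 = 0 ∧
    NFcubic δ 0 1 1 2 = 0 ∧ NFcubic δ 0 0 1 2 = 0 ∧ NFcubic δ 1 1 1 2 = 0 := by
  have ⟨h1, h2, h3, _⟩ := NFcubic_isHarm δ
  have h01 (k : Fin 3) := NFcubic_odd δ (i := 0) (j := 1) (k := k) (by decide)
  have h02 (k : Fin 3) := NFcubic_odd δ (i := 0) (j := 2) (k := k) (by decide)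
  have h12 (k : Fin 3) := NFcubic_odd δ (i := 1) (j := 2) (k := k) (by decide)
  have a := h01 0
  have b := h02 0
  have c := h02 1
  have d := h12 0
  have e := h12 1
  simp only [h1, h2, h3] at a b c d e
  exact ⟨a, h01 1, b, c, d, e⟩

theorem d2_NFcubic (δ : ℝ) : d2 (NFcubic δ) = (160 * δ ^ 2) • 1 := by
  have ⟨h1, h2, h3, _⟩ := NFcubic_isHarm δ
  obtain ⟨r1, r2, r3, r4, r5, -⟩ := (NFcubic_isHarm δ).trace_relations
  obtain ⟨o1, o2, o3, o4, o5, o6⟩ := NFcubic_odd_components δ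
  have u := NFcubic_iijj δ (i := 0) (j := 1) (by decide)
  suffices h : ∀ i j, d2 (NFcubic δ) i j = ((160 * δ ^ 2) • (1 : Mat3)) i j by
    ext i j
    exact h i j
  simp only [d2, Matrix.of_apply, sqT, Fin.sum_univ_three, Fin.forall_fin_three, NFcubic_iiii, h1,
    h2, h3, r1, r2, r3, r4, r5, o1, o2, o3, o4, o5, o6, u, Matrix.smul_apply,
    Matrix.one_apply]
  norm_num
  ring_nf
  simp

theorem J3_NFcubic (δ : ℝ) : J3 (NFcubic δ) = 1920 * δ ^ 3 := by
  have ⟨h1, h2, h3, _⟩ := NFcubic_isHarm δ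
  obtain ⟨r1, r2, r3, r4, r5, -⟩ := (NFcubic_isHarm δ).trace_relations
  obtain ⟨o1, o2, o3, o4, o5, o6⟩ := NFcubic_odd_components δ
  have u := NFcubic_iijj δ (i := 0) (j := 1) (by decide)
  simp only [J3_eq_sum, cbT, sqT, Fin.sum_univ_three, NFcubic_iiii, h1, h2, h3, r1, r2, r3, r4,
    r5, o1, o2, o3, o4, o5, o6, u]
  ring

theorem IsHarm.invariants_of_isotropic {D : T4} (hD : IsHarm D) {c : ℝ} (hd : d2 D = c • 1) :
    J2 D = 3 * c ∧ J4 D = 3 * c ^ 2 ∧ J5 D = 0 ∧ J6 D = 3 * c ^ 3 ∧ J7 D = 0 ∧ J8 D = 0 ∧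
      J9 D = 0 ∧ J10 D = 0 := by
  have hs (k l : Fin 3) : D 2 2 k l = -D 0 0 k l - D 1 1 k l := by
    have := hD.2.2.2 k l
    rw [Fin.sum_univ_three] at this
    linarith
  refine ⟨?_, ?_, ?_, ?_, ?_, ?_, ?_, ?_⟩ <;>
    simp [J2, J4, J5, J6, J7, J8, J9, J10, hd, sqT, Fin.sum_univ_three, Matrix.one_apply, hs,
      Matrix.trace] <;> ring

theorem IsHarm.cubic_components_of_diagonal {D : T4} (hD : IsHarm D) {δ : ℝ}
    (hq : ∀ i j k l, sqT D i j k l = 4 * δ * D i j k l + 96 * δ ^ 2 * devProj i j k l)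
    {a b c : Fin 3} (hab : a ≠ b) (hac : a ≠ c) (hbc : b ≠ c)
    (hsum : ∀ f : Fin 3 → ℝ, ∑ i, f i = f a + f b + f c) {v : Fin 3 → ℝ} (ha : v a ≠ 0)
    (hb : v b = -v a) (hc : v c = 0)
    (hv : contract D (Matrix.diagonal v) = (12 * δ) • Matrix.diagonal v) :
    (D a a a a = 8 * δ ∧ D b b b b = 8 * δ ∧ D c c c c = 8 * δ) ∧
    (D a a b b = -(4 * δ) ∧ D a a c c = -(4 * δ) ∧ D b b c c = -(4 * δ)) ∧
    (D a a a b = 0 ∧ D a b b b = 0 ∧ D a b c c = 0) ∧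
    (D a a a c = 0 ∧ D a b b c = 0 ∧ D a c c c = 0) ∧
    (D a a b c = 0 ∧ D b b b c = 0 ∧ D b c c c = 0) := by
  obtain ⟨h1, h2, h3, h4⟩ := hD
  have hv' (i j : Fin 3) : D i j a a - D i j b b = 12 * δ * Matrix.diagonal v i j / v a := by
    have h := congrFun₂ hv i j
    simp only [contract, Matrix.of_apply, hsum, Matrix.smul_apply, smul_eq_mul] at h
    simp only [Matrix.diagonal_apply_eq, Matrix.diagonal_apply_ne _ hab,
      Matrix.diagonal_apply_ne _ hab.symm, Matrix.diagonal_apply_ne _ hac,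
      Matrix.diagonal_apply_ne _ hac.symm, Matrix.diagonal_apply_ne _ hbc,
      Matrix.diagonal_apply_ne _ hbc.symm, hb, hc] at h
    field_simp
    linarith
  have e1 := hv' a a
  have e2 := hv' b b
  have e3 := hv' c c
  have e4 := hv' a b
  have e5 := hv' a c
  have e6 := hv' b c
  rw [Matrix.diagonal_apply_eq, mul_div_assoc, div_self ha] at e1
  rw [Matrix.diagonal_apply_eq, hb, mul_div_assoc, neg_div, div_self ha] at e2
  rw [Matrix.diagonal_apply_eq, hc] at e3
  rw [Matrix.diagonal_apply_ne _ hab] at e4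
  rw [Matrix.diagonal_apply_ne _ hac] at e5
  rw [Matrix.diagonal_apply_ne _ hbc] at e6
  have t1 := h4 a a
  have t2 := h4 b b
  have t3 := h4 c c
  have t4 := h4 a b
  have t5 := h4 a c
  have t6 := h4 b c
  have q1 := hq a b a b
  have q2 := hq a c a c
  simp only [sqT, hsum] at q1 q2 t1 t2 t3 t4 t5 t6
  simp only [devProj, hab, hab.symm, hac, hac.symm, if_true, if_false] at q1 q2
  simp only [h1, h2, h3, mul_zero, zero_div] at e1 e2 e3 e4 e5 e6 t1 t2 t3 t4 t5 t6 q1 q2 ⊢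
  have x1 : D a a b b = D a a a a - 12 * δ := by linarith
  have x2 : D b b b b = D a a a a := by linarith
  have x3 : D b b c c = 12 * δ - 2 * D a a a a := by linarith
  have x4 : D a a c c = 12 * δ - 2 * D a a a a := by linarith
  have x5 : D c c c c = 4 * D a a a a - 24 * δ := by linarith
  have x6 : D a b b b = D a a a b := by linarith
  have x7 : D a b c c = -2 * D a a a b := by linarith
  have x8 : D a b b c = D a a a c := by linarith
  have x9 : D a c c c = -2 * D a a a c := by linarith
  have x10 : D b b b c = D a a b c := by linarith
  have x11 : D b c c c = -2 * D a a b c := by linarith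
  simp only [x1, x2, x3, x4, x5, x6, x7, x8, x9, x10, x11] at q1 q2 ⊢
  have key : 20 * D a a a b ^ 2 + 10 * D a a a c ^ 2 + 6 * D a a b c ^ 2 +
      12 * (D a a a a - 8 * δ) ^ 2 = 0 := by
    linear_combination 2 * q1 + q2
  obtain ⟨hp, hq, hr, hu⟩ : D a a a b = 0 ∧ D a a a c = 0 ∧ D a a b c = 0 ∧
      D a a a a - 8 * δ = 0 := by
    have hp := sq_nonneg (D a a a b)
    have hq := sq_nonneg (D a a a c)
    have hr := sq_nonneg (D a a b c)
    have hu := sq_nonneg (D a a a a - 8 * δ)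
    clear * - key hp hq hr hu
    refine ⟨?_, ?_, ?_, ?_⟩ <;> refine sq_eq_zero_iff.1 ?_ <;> linarith
  have hu' : D a a a a = 8 * δ := by linarith
  rw [hp, hq, hr, hu']
  refine ⟨⟨?_, ?_, ?_⟩, ⟨?_, ?_, ?_⟩, ⟨?_, ?_, ?_⟩, ⟨?_, ?_, ?_⟩, ?_, ?_, ?_⟩ <;> ring

theorem exists_det_cos_smul_add_sin_smul_eq_zero (A B : Mat3) :
    ∃ t : ℝ, (Real.cos t • A + Real.sin t • B).det = 0 := by
  have hc : Continuous fun t : ℝ => (Real.cos t • A + Real.sin t • B).det := by fun_prop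
  have hpi : (Real.cos Real.pi • A + Real.sin Real.pi • B).det =
      -(Real.cos 0 • A + Real.sin 0 • B).det := by
    simp [Matrix.det_neg, Odd.neg_one_pow (show Odd 3 by decide)]
  have h0 : (0 : ℝ) ∈ Set.uIcc (Real.cos 0 • A + Real.sin 0 • B).det
      (Real.cos Real.pi • A + Real.sin Real.pi • B).det := by
    rw [hpi, Set.mem_uIcc]
    rcases le_total 0 (Real.cos 0 • A + Real.sin 0 • B).det with h | h
    · right; constructor <;> linarith
    · left; constructor <;> linarith
  obtain ⟨t, -, ht⟩ := intermediate_value_uIcc hc.continuousOn h0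
  exact ⟨t, ht⟩

/-- `20 δ` times the orthogonal projection onto the `12 δ`-eigenspace of a cubic tensor. -/
noncomputable def eigenProj (D : T4) (δ : ℝ) : T4 := fun i j k l =>
  D i j k l + 8 * δ * devProj i j k l

theorem IsHarm.eigenProj_sums {D : T4} (hD : IsHarm D) (δ : ℝ) :
    ∑ i, ∑ j, eigenProj D δ i j i j = 40 * δ ∧
    ∑ i, ∑ j, ∑ k, ∑ l, eigenProj D δ i j k l * eigenProj D δ k l i j =
      J2 D + 320 * δ ^ 2 := by
  obtain ⟨r1, r2, r3, r4, r5, r6⟩ := hD.trace_relations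
  obtain ⟨h1, h2, h3, h4⟩ := hD
  constructor <;>
    simp [eigenProj, J2, d2, sqT, devProj, Matrix.trace, Fin.sum_univ_three, h1, h2, h3, r1, r2,
      r3, r4, r5, r6] <;> ring

theorem IsHarm.exists_eigenmatrix {D : T4} (hD : IsHarm D) {δ : ℝ} (hδ : δ ≠ 0)
    (hJ : J2 D = 480 * δ ^ 2)
    (hq : ∀ i j k l, sqT D i j k l = 4 * δ * D i j k l + 96 * δ ^ 2 * devProj i j k l) :
    ∃ A : Mat3, Aᵀ = A ∧ A ≠ 0 ∧ A.trace = 0 ∧ A.det = 0 ∧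
      contract D A = (12 * δ) • A := by
  set N : Fin 3 → Fin 3 → Mat3 := fun k l => Matrix.of fun i j => eigenProj D δ i j k l with hN
  have hNt (k l : Fin 3) : (N k l)ᵀ = N k l := by
    ext i j
    simp only [hN, Matrix.transpose_apply, Matrix.of_apply, eigenProj, hD.1 i j, devProj,
      @eq_comm _ i j]
    ring
  have hNtr (k l : Fin 3) : (N k l).trace = 0 := by
    have h := hD.2.2.2 k l
    rw [Fin.sum_univ_three] at h
    simp only [Matrix.trace, Matrix.diag_apply, hN, Matrix.of_apply, eigenProj,
      Fin.sum_univ_three]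
    rw [show D 2 2 k l = - D 0 0 k l - D 1 1 k l by linarith]
    revert k l
    simp [Fin.forall_fin_three, devProj]
    refine ⟨fun _ => ?_, fun _ => ?_, fun _ => ?_⟩ <;> ring
  have hNc (k l : Fin 3) : contract D (N k l) = (12 * δ) • N k l := by
    ext i j
    have h : contract D (N k l) i j = sqT D i j k l + 8 * δ * D i j k l := by
      have h := hD.2.2.2 i j
      have h' (p : Fin 3) : D p p i j = D i j p p :=
        (hD.2.1 ..).trans <| (hD.1 ..).trans <| (hD.2.2.1 ..).trans (hD.2.1 ..)
      have hs10 : D i j 1 0 = D i j 0 1 := hD.2.2.1 ..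
      have hs20 : D i j 2 0 = D i j 0 2 := hD.2.2.1 ..
      have hs21 : D i j 2 1 = D i j 1 2 := hD.2.2.1 ..
      rw [Fin.sum_univ_three] at h
      simp only [h'] at h
      have h22 : D i j 2 2 = -D i j 0 0 - D i j 1 1 := by linarith
      simp only [contract, hN, Matrix.of_apply, eigenProj, sqT, mul_add, Finset.sum_add_distrib]
      congr 1
      revert k l
      simp [Fin.forall_fin_three, devProj, Fin.sum_univ_three, hs10, hs20, hs21, h22]
      refine ⟨⟨?_, ?_, ?_⟩, ⟨?_, ?_, ?_⟩, ?_, ?_, ?_⟩ <;> ring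
    rw [h, hq]
    simp only [hN, Matrix.smul_apply, Matrix.of_apply, eigenProj, smul_eq_mul]
    ring
  by_contra hcon
  have hdep (k l k' l' : Fin 3) (i j i' j' : Fin 3) :
      N k l i j * N k' l' i' j' = N k l i' j' * N k' l' i j := by
    obtain ⟨t, ht⟩ := exists_det_cos_smul_add_sin_smul_eq_zero (N k l) (N k' l')
    have h0 : Real.cos t • N k l + Real.sin t • N k' l' = 0 := by
      by_contra hne
      refine hcon ⟨_, ?_, hne, ?_, ht, ?_⟩
      · simp [hNt]
      · simp [hNtr]
      · have h (c s : ℝ) (A B : Mat3) :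
            contract D (c • A + s • B) = c • contract D A + s • contract D B := by
          ext i j
          simp only [contract, Matrix.of_apply, Matrix.add_apply, Matrix.smul_apply, smul_eq_mul,
            Fin.sum_univ_three]
          ring
        rw [h, hNc, hNc, smul_add, smul_comm, smul_comm (Real.sin t)]
    have e := congrFun₂ h0 i j
    have e' := congrFun₂ h0 i' j'
    simp only [Matrix.add_apply, Matrix.smul_apply, smul_eq_mul, Matrix.zero_apply] at e e'
    have hcs := Real.cos_sq_add_sin_sq t
    linear_combination (N k l i' j' * N k' l' i j - N k l i j * N k' l' i' j') * hcs +
      (Real.cos t * N k' l' i' j' - Real.sin t * N k l i' j') * e -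
      (Real.cos t * N k' l' i j - Real.sin t * N k l i j) * e'
  obtain ⟨s1, s2⟩ := hD.eigenProj_sums δ
  have hsq : (∑ i, ∑ j, eigenProj D δ i j i j) * (∑ k, ∑ l, eigenProj D δ k l k l) =
      ∑ i, ∑ j, ∑ k, ∑ l, eigenProj D δ i j k l * eigenProj D δ k l i j := by
    simp only [Finset.sum_mul, Finset.mul_sum]
    refine Finset.sum_congr rfl fun i _ => Finset.sum_congr rfl fun j _ =>
      Finset.sum_congr rfl fun k _ => Finset.sum_congr rfl fun l _ => ?_
    have h := hdep i j k l i j k l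
    simp only [hN, Matrix.of_apply] at h
    linear_combination h
  rw [s1, s2, hJ] at hsq
  have : δ ^ 2 = 0 := by linarith
  exact hδ (by simpa using this)

theorem exists_isSO3_diagonalizing {A : Mat3} (hA : Aᵀ = A) :
    ∃ (g : Mat3) (v : Fin 3 → ℝ), IsSO3 g ∧ g * A * gᵀ = Matrix.diagonal v := by
  have hH : A.IsHermitian := by
    rwa [Matrix.IsHermitian, Matrix.conjTranspose_eq_transpose_of_trivial]
  obtain ⟨h, v, hh, hv⟩ : ∃ (h : Mat3) (v : Fin 3 → ℝ), h * hᵀ = 1 ∧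
      h * A * hᵀ = Matrix.diagonal v := by
    refine ⟨(hH.eigenvectorUnitary : Mat3)ᵀ, hH.eigenvalues, ?_, ?_⟩
    · have := Unitary.coe_star_mul_self hH.eigenvectorUnitary
      rwa [Matrix.star_eq_conjTranspose, Matrix.conjTranspose_eq_transpose_of_trivial] at this
    · have := hH.conjStarAlgAut_star_eigenvectorUnitary
      rw [Unitary.conjStarAlgAut_star_apply] at this
      simpa [Matrix.star_eq_conjTranspose, Matrix.conjTranspose_eq_transpose_of_trivial] using this
  have hdet : h.det * h.det = 1 := by
    simpa using congrArg Matrix.det hh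
  rcases mul_self_eq_one_iff.1 hdet with h1 | h1
  · exact ⟨h, v, ⟨hh, h1⟩, hv⟩
  · refine ⟨-h, v, ⟨by simpa using hh, ?_⟩, by simpa using hv⟩
    rw [Matrix.det_neg, h1]
    norm_num

theorem IsSO3.transpose_mul_self {g : Mat3} (hg : IsSO3 g) : gᵀ * g = 1 :=
  mul_eq_one_comm.1 hg.1

theorem IsHarm.eq_NFcubic_of_diagonal {D : T4} (hD : IsHarm D) {δ : ℝ}
    (hq : ∀ i j k l, sqT D i j k l = 4 * δ * D i j k l + 96 * δ ^ 2 * devProj i j k l)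
    {v : Fin 3 → ℝ} (hv0 : v ≠ 0) (htr : ∑ i, v i = 0) (hdet : ∏ i, v i = 0)
    (hv : contract D (Matrix.diagonal v) = (12 * δ) • Matrix.diagonal v) :
    D = NFcubic δ := by
  obtain ⟨o1, o2, o3, o4, o5, o6⟩ := NFcubic_odd_components δ
  have n01 := NFcubic_iijj δ (i := 0) (j := 1) (by decide)
  have ⟨h1, h2, h3, _⟩ := hD
  rw [Fin.sum_univ_three] at htr
  rw [Fin.prod_univ_three] at hdet
  have hD' {a b c : Fin 3} := hD.cubic_components_of_diagonal hq (a := a) (b := b) (c := c) (v := v)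
  have hne (h : v 0 = 0) (h' : v 1 = 0) (h'' : v 2 = 0) : False :=
    hv0 (funext (Fin.forall_fin_three.2 ⟨h, h', h''⟩))
  suffices h : D 0 0 0 0 = 8 * δ ∧ D 1 1 1 1 = 8 * δ ∧ D 0 0 1 1 = -(4 * δ) ∧ D 0 0 0 1 = 0 ∧
      D 0 1 1 1 = 0 ∧ D 0 0 0 2 = 0 ∧ D 0 1 1 2 = 0 ∧ D 0 0 1 2 = 0 ∧ D 1 1 1 2 = 0 by
    obtain ⟨c1, c2, c3, c4, c5, c6, c7, c8, c9⟩ := h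
    refine hD.ext (NFcubic_isHarm δ) ?_ ?_ ?_ ?_ ?_ ?_ ?_ ?_ ?_ <;>
      simp only [NFcubic_iiii, n01, o1, o2, o3, o4, o5, o6, c1, c2, c3, c4, c5, c6, c7, c8, c9]
  rcases mul_eq_zero.1 hdet with h | h
  · rcases mul_eq_zero.1 h with h | h
    · have h12 : v 2 = -v 1 := by linarith
      have := hD' (a := 1) (b := 2) (c := 0) (by decide) (by decide) (by decide)
        (fun f => by rw [Fin.sum_univ_three]; ring) (fun h' => hne h h' (by linarith)) h12 h hv
      simp only [h1, h2, h3] at this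
      simp only [this, and_self]
    · have h12 : v 2 = -v 0 := by linarith
      have := hD' (a := 0) (b := 2) (c := 1) (by decide) (by decide) (by decide)
        (fun f => by rw [Fin.sum_univ_three]; ring) (fun h' => hne h' h (by linarith)) h12 h hv
      simp only [h1, h2, h3] at this
      simp only [this, and_self]
  · have h12 : v 1 = -v 0 := by linarith
    have := hD' (a := 0) (b := 1) (c := 2) (by decide) (by decide) (by decide)
      (fun f => by rw [Fin.sum_univ_three]) (fun h' => hne h' (by linarith) h) h12 h hv
    simp only [this, and_self]

theorem IsHarm.exists_act_eq_NFcubic {D : T4} (hD : IsHarm D) {δ : ℝ} (hδ : δ ≠ 0)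
    (hd : d2 D = (160 * δ ^ 2) • 1) (hJ : J3 D = 1920 * δ ^ 3) :
    ∃ g, IsSO3 g ∧ act g D = NFcubic δ := by
  have hJ2 : J2 D = 480 * δ ^ 2 := by rw [(hD.invariants_of_isotropic hd).1]; ring
  obtain ⟨A, hA, hA0, htr, hdet, hc⟩ := hD.exists_eigenmatrix hδ hJ2 (hD.sqT_eq hd hJ)
  obtain ⟨g, v, hg, hv⟩ := exists_isSO3_diagonalizing hA
  have hg' := hg.transpose_mul_self
  have hd' : d2 (act g D) = (160 * δ ^ 2) • 1 := by
    rw [d2_act hg', hd]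
    simp [hg.1]
  refine ⟨g, hg, (isHarm_act hD hg').eq_NFcubic_of_diagonal (v := v)
    ((isHarm_act hD hg').sqT_eq hd' (by rw [J3_act hg', hJ])) ?_ ?_ ?_ ?_⟩
  · rintro rfl
    apply hA0
    have h : gᵀ * (g * A * gᵀ) * g = 0 := by simp [hv]
    rwa [show gᵀ * (g * A * gᵀ) * g = (gᵀ * g) * A * (gᵀ * g) by simp only [Matrix.mul_assoc], hg',
      Matrix.one_mul, Matrix.mul_one] at h
  · rw [← Matrix.trace_diagonal, ← hv, Matrix.trace_mul_comm, ← Matrix.mul_assoc, hg',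
      Matrix.one_mul, htr]
  · rw [← Matrix.det_diagonal, ← hv, Matrix.det_mul, Matrix.det_mul, hdet]
    simp
  · rw [← hv, contract_act hg', hc]
    simp

theorem IsHarm.J2_eq_sum_sq {D : T4} (hD : IsHarm D) :
    J2 D = ∑ i, ∑ j, ∑ k, ∑ l, D i j k l ^ 2 := by
  obtain ⟨h1, h2, h3, -⟩ := hD
  simp only [J2, d2, sqT, Matrix.trace, Matrix.diag_apply, Matrix.of_apply]
  rw [Finset.sum_comm]
  refine Finset.sum_congr rfl fun i _ => Finset.sum_congr rfl fun j _ =>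
    Finset.sum_congr rfl fun k _ => Finset.sum_congr rfl fun l _ => ?_
  rw [sq, h2 k l i j, h1 k i l j, h3 i k l j, h2 i k j l]

theorem IsHarm.eq_zero_of_J2_eq_zero {D : T4} (hD : IsHarm D) (h : J2 D = 0) : D = 0 := by
  rw [hD.J2_eq_sum_sq] at h
  have h1 : ∑ x : Fin 3 × Fin 3 × Fin 3 × Fin 3, D x.1 x.2.1 x.2.2.1 x.2.2.2 ^ 2 = 0 := by
    simpa only [Fintype.sum_prod_type] using h
  ext i j k l
  exact sq_eq_zero_iff.1 <| (Finset.sum_eq_zero_iff_of_nonneg fun _ _ => sq_nonneg _).1 h1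
    (i, j, k, l) (Finset.mem_univ _)

theorem IsHarm.d2_transpose {D : T4} (hD : IsHarm D) : (d2 D)ᵀ = d2 D := by
  obtain ⟨h1, h2, h3, -⟩ := hD
  have h (i j p q : Fin 3) : D i j p q = D p q i j := by
    rw [h2, h1, h3, h2]
  ext j l
  simp only [d2, sqT, Matrix.transpose_apply, Matrix.of_apply]
  refine Finset.sum_congr rfl fun i _ => Finset.sum_congr rfl fun p _ =>
    Finset.sum_congr rfl fun q _ => ?_
  rw [mul_comm, h p q i j, h i l p q]

theorem IsHarm.d2_isotropic {D : T4} (hD : IsHarm D) (h : 3 * J4 D = J2 D ^ 2) :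
    d2 D = (J2 D / 3) • 1 := by
  rw [← sub_eq_zero, ← Matrix.trace_mul_conjTranspose_self_eq_zero_iff,
    Matrix.conjTranspose_eq_transpose_of_trivial, Matrix.transpose_sub, hD.d2_transpose]
  have e : ((d2 D - (J2 D / 3) • 1) * (d2 D - ((J2 D / 3) • 1)ᵀ)).trace =
      J4 D - J2 D ^ 2 / 3 := by
    simp only [Matrix.transpose_smul, Matrix.transpose_one, Matrix.sub_mul, Matrix.mul_sub,
      Matrix.smul_mul, Matrix.mul_smul, Matrix.one_mul, Matrix.mul_one, Matrix.trace_sub,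
      Matrix.trace_smul, Matrix.trace_one, smul_eq_mul]
    rw [show (d2 D * d2 D).trace = J4 D from rfl, show (d2 D).trace = J2 D from rfl]
    simp only [Fintype.card_fin]
    ring
  rw [e]
  linarith

theorem d2_J3_of_act_eq_NFcubic {D : T4} {g : Mat3} {δ : ℝ} (hg : IsSO3 g)
    (h : act g D = NFcubic δ) : d2 D = (160 * δ ^ 2) • 1 ∧ J3 D = 1920 * δ ^ 3 := by
  have hg' := hg.transpose_mul_self
  refine ⟨?_, by rw [← J3_act hg', h, J3_NFcubic]⟩
  have e : gᵀ * d2 (act g D) * g = (gᵀ * g) * d2 D * (gᵀ * g) := by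
    rw [d2_act hg']
    simp only [Matrix.mul_assoc]
  rw [hg', Matrix.one_mul, Matrix.mul_one, h, d2_NFcubic] at e
  rw [← e]
  simp [hg']

/-- a harmonic tensor `D ∈ H⁴` lies in the closed cubic stratum (some rotation
brings it to the cubic normal form) iff its fundamental invariants satisfy
`3J₄ = J₂²`, `J₅ = 0`, `30J₃² = J₂³`, `9J₆ = J₂³`, `J₇ = J₈ = J₉ = J₁₀ = 0`;
moreover, when `J₂ ≠ 0`, the parameter is given by `4δ = J₃/J₂`. -/
theorem cubic_stratum_characterization (D : T4) (hD : IsHarm D) :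
    ((∃ (g : Mat3) (δ : ℝ), IsSO3 g ∧ act g D = NFcubic δ) ↔
      (3 * J4 D = (J2 D) ^ 2 ∧ J5 D = 0 ∧ 30 * (J3 D) ^ 2 = (J2 D) ^ 3 ∧
       9 * J6 D = (J2 D) ^ 3 ∧ J7 D = 0 ∧ J8 D = 0 ∧ J9 D = 0 ∧ J10 D = 0)) ∧
    (∀ (g : Mat3) (δ : ℝ), IsSO3 g → act g D = NFcubic δ → J2 D ≠ 0 →
      4 * δ = J3 D / J2 D) := by
  refine ⟨⟨?_, ?_⟩, ?_⟩
  · rintro ⟨g, δ, hg, h⟩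
    obtain ⟨hd, hJ3⟩ := d2_J3_of_act_eq_NFcubic hg h
    obtain ⟨j2, j4, j5, j6, j7, j8, j9, j10⟩ := hD.invariants_of_isotropic hd
    refine ⟨?_, j5, ?_, ?_, j7, j8, j9, j10⟩
    · rw [j2, j4]; ring
    · rw [j2, hJ3]; ring
    · rw [j2, j6]; ring
  · rintro ⟨h4, -, h3, -⟩
    by_cases h2 : J2 D = 0
    · refine ⟨1, 0, ⟨by simp, by simp⟩, ?_⟩
      have hz : NFcubic 0 = 0 := by
        ext i j k l
        simp [NFcubic, symT]
      rw [hD.eq_zero_of_J2_eq_zero h2, hz]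
      ext i j k l
      simp [act]
    · have hJ : 30 * (J3 D / J2 D) ^ 2 = J2 D := by
        field_simp
        linarith
      have hδ : J3 D / J2 D / 4 ≠ 0 := by
        intro h0
        rw [div_eq_zero_iff, or_iff_left (by norm_num)] at h0
        rw [h0] at hJ
        exact h2 (by linarith)
      obtain ⟨g, hg, h⟩ := hD.exists_act_eq_NFcubic hδ
        (by rw [hD.d2_isotropic h4]; congr 1; linarith)
        (by
          have h : J3 D = J3 D / J2 D * J2 D := (div_mul_cancel₀ _ h2).symm
          linear_combination h - J3 D / J2 D * hJ)
      exact ⟨g, J3 D / J2 D / 4, hg, h⟩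
  · intro g δ hg h h2
    obtain ⟨hd, hJ3⟩ := d2_J3_of_act_eq_NFcubic hg h
    rw [eq_div_iff h2, hJ3, (hD.invariants_of_isotropic hd).1]
    ring
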